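/- Let A be a (possibly non-unital) associative k-algebra and β : A → A a Baxter operator. Define operations on A by x ≻ y := β(x)·y and x ≺ y := x·β(y). Then (A, ≻, ≺) is a dendriform algebra. -/

import Mathlib

/-- A Baxter operator `β` on an associative algebra `A` yields a dendriform algebra
structure on `A` via `x ≻ y := β(x)·y` and `x ≺ y := x·β(y)`. -/
theorem baxter_gives_dendriform {k A : Type*} [CommRing k] [NonUnitalRing A]
    [Module k A] [SMulCommClass k A A] [IsScalarTower k A A]
    (β : A →ₗ[k] A) (hβ : ∀ x y : A, β x * β y = β (x * β y + β x * y))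
    (succ prec : A → A → A)
    (hsucc : ∀ x y : A, succ x y = β x * y)
    (hprec : ∀ x y : A, prec x y = x * β y) :
    (∀ x y z : A, prec (prec x y) z = prec x (prec y z) + prec x (succ y z))
    ∧ (∀ x y z : A, succ x (prec y z) = prec (succ x y) z)
    ∧ (∀ x y z : A, succ x (succ y z) = succ (prec x y) z + succ (succ x y) z) := by
  refine ⟨fun x y z => ?_, fun x y z => ?_, fun x y z => ?_⟩
  · simp only [hsucc, hprec]
    rw [mul_assoc, hβ, map_add, mul_add]
  · simp only [hsucc, hprec, mul_assoc]
  · simp only [hsucc, hprec]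
    rw [← mul_assoc, hβ, map_add, add_mul]
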